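/- For every integer k ≥ 3 and every constant d > 0 there exists a constant c > 0 such that the following holds. Let n and ℓ be integers with k < ℓ ≤ d·√n, and let P be a set of n points in the plane ℝ² with at most ℓ collinear. Then P contains a subset of at least c·n^((k−1)/k) / ℓ^((k−2)/k) points with at most k collinear. -/

import Mathlib

/-- A finite point set has "at most k collinear" if every collinear subset has ≤ k points. -/
def AtMostCollinear (P : Finset (ℝ × ℝ)) (k : ℕ) : Prop :=
  ∀ T ⊆ P, Collinear ℝ (T : Set (ℝ × ℝ)) → T.card ≤ k

section

open Finset

/-- A segment of a non-vertical line: `(line, left endpoint, right endpoint)`, where the line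
`(a, b)` is the graph of `x ↦ a * x + b`. -/
abbrev Seg := (ℝ × ℝ) × (ℝ × ℝ) × (ℝ × ℝ)

namespace Seg

/-- The slope of the supporting line. -/
abbrev slope (e : Seg) : ℝ := e.1.1

/-- The left endpoint. -/
abbrev left (e : Seg) : ℝ × ℝ := e.2.1

/-- The right endpoint. -/
abbrev right (e : Seg) : ℝ × ℝ := e.2.2

/-- The height of the supporting line above `x`. -/
def height (e : Seg) (x : ℝ) : ℝ := e.1.1 * x + e.1.2

/-- `e` joins two points of `V` and has no point of `V` in its interior. -/
structure IsEdge (V : Finset (ℝ × ℝ)) (e : Seg) : Prop where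
  left_mem : e.left ∈ V
  right_mem : e.right ∈ V
  lt : e.left.1 < e.right.1
  left_on : e.left.2 = e.height e.left.1
  right_on : e.right.2 = e.height e.right.1
  interior : ∀ z ∈ V, e.left.1 < z.1 → z.1 < e.right.1 → z.2 ≠ e.height z.1

/-- The relative interiors of two segments meet. -/
def Meets (e f : Seg) : Prop :=
  ∃ x, e.left.1 < x ∧ x < e.right.1 ∧ f.left.1 < x ∧ x < f.right.1 ∧ e.height x = f.height x

variable {V : Finset (ℝ × ℝ)} {e f : Seg}

lemma IsEdge.mono {W : Finset (ℝ × ℝ)} (he : IsEdge V e) (hW : W ⊆ V) (hl : e.left ∈ W)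
    (hr : e.right ∈ W) : IsEdge W e :=
  ⟨hl, hr, he.lt, he.left_on, he.right_on, fun z hz => he.interior z (hW hz)⟩

lemma IsEdge.eq_of_overlap (he : IsEdge V e) (hf : IsEdge V f) (hline : e.1 = f.1) {x : ℝ}
    (h1 : e.left.1 < x) (h2 : x < e.right.1) (h3 : f.left.1 < x) (h4 : x < f.right.1) :
    e = f := by
  have hh : ∀ y, e.height y = f.height y := fun y => by simp [height, hline]
  have hl : e.left.1 = f.left.1 := by
    rcases lt_trichotomy e.left.1 f.left.1 with h | h | h
    · exact absurd (hf.left_on.trans (hh _).symm)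
        (he.interior _ hf.left_mem h (by linarith))
    · exact h
    · exact absurd (he.left_on.trans (hh _)) (hf.interior _ he.left_mem h (by linarith))
  have hr : e.right.1 = f.right.1 := by
    rcases lt_trichotomy e.right.1 f.right.1 with h | h | h
    · exact absurd (he.right_on.trans (hh _)) (hf.interior _ he.right_mem (by linarith) h)
    · exact h
    · exact absurd (hf.right_on.trans (hh _).symm)
        (he.interior _ hf.right_mem (by linarith) h)
  refine Prod.ext hline (Prod.ext (Prod.ext hl ?_) (Prod.ext hr ?_))
  · exact he.left_on.trans ((hh _).trans (by rw [hf.left_on, hl]))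
  · exact he.right_on.trans ((hh _).trans (by rw [hf.right_on, hr]))

lemma line_eq_of_height_eq {x y : ℝ} (hxy : x ≠ y) (hx : e.height x = f.height x)
    (hy : e.height y = f.height y) : e.1 = f.1 := by
  unfold height at hx hy
  have hs : e.1.1 = f.1.1 := by
    apply mul_right_cancel₀ (sub_ne_zero.mpr hxy)
    linarith
  refine Prod.ext hs ?_
  rw [hs] at hx
  linarith

lemma line_eq_of_slope_eq {x : ℝ} (hs : e.slope = f.slope) (hx : e.height x = f.height x) :
    e.1 = f.1 := by
  refine Prod.ext hs ?_
  simp only [height, slope] at hx hs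
  rw [hs] at hx
  linarith

lemma IsEdge.eq_of_left_eq (he : IsEdge V e) (hf : IsEdge V f) (hl : e.left = f.left)
    (hs : e.slope = f.slope) : e = f := by
  obtain ⟨x, h1, h2⟩ := exists_between (lt_min he.lt (hl ▸ hf.lt))
  refine he.eq_of_overlap hf (line_eq_of_slope_eq (x := e.left.1) hs ?_) h1
    (h2.trans_le (min_le_left _ _)) (hl ▸ h1) (h2.trans_le (min_le_right _ _))
  rw [← he.left_on, hl, ← hf.left_on]

lemma IsEdge.eq_of_right_eq (he : IsEdge V e) (hf : IsEdge V f) (hr : e.right = f.right)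
    (hs : e.slope = f.slope) : e = f := by
  obtain ⟨x, h1, h2⟩ := exists_between (max_lt he.lt (hr ▸ hf.lt))
  refine he.eq_of_overlap hf (line_eq_of_slope_eq (x := e.right.1) hs ?_)
    ((le_max_left _ _).trans_lt h1) h2 ((le_max_right _ _).trans_lt h1) (hr ▸ h2)
  rw [← he.right_on, hr, ← hf.right_on]

lemma height_sub (e : Seg) (x y : ℝ) : e.height x - e.height y = e.slope * (x - y) := by
  simp only [height]; ring

lemma meets_of_lt_of_lt {x y : ℝ} (hxy : x < y) (h1 : e.left.1 ≤ x) (h2 : y ≤ e.right.1)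
    (h3 : f.left.1 ≤ x) (h4 : y ≤ f.right.1)
    (h : (e.height x < f.height x ∧ f.height y < e.height y) ∨
      (f.height x < e.height x ∧ e.height y < f.height y)) : Meets e f := by
  have hs : e.slope - f.slope ≠ 0 := by
    intro h0
    have := height_sub e x y
    have := height_sub f x y
    rw [sub_eq_zero.mp h0] at *
    rcases h with h | h <;> linarith
  obtain ⟨z, hz⟩ : ∃ z, e.height z = f.height z := by
    refine ⟨(f.1.2 - e.1.2) / (e.slope - f.slope), ?_⟩
    simp only [height]
    have : (e.slope - f.slope) * ((f.1.2 - e.1.2) / (e.slope - f.slope)) = f.1.2 - e.1.2 :=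
      mul_div_cancel₀ _ hs
    simp only [slope] at this ⊢
    linarith
  have hx : e.height x - f.height x = (e.slope - f.slope) * (x - z) := by
    linarith [height_sub e x z, height_sub f x z]
  have hy : e.height y - f.height y = (e.slope - f.slope) * (y - z) := by
    linarith [height_sub e y z, height_sub f y z]
  have hzz : x < z ∧ z < y := by
    constructor
    · by_contra! hc
      rcases h with h | h <;> rcases lt_or_gt_of_ne hs with hs | hs <;> nlinarith
    · by_contra! hc
      rcases h with h | h <;> rcases lt_or_gt_of_ne hs with hs | hs <;> nlinarith
  exact ⟨z, by linarith, by linarith, by linarith, by linarith, hz⟩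

/-- Two edges which do not meet keep their vertical order. -/
lemma height_le_of_not_meets {x y : ℝ} (hef : ¬ Meets e f)
    (hx : x ∈ Set.Icc e.left.1 e.right.1) (hx' : x ∈ Set.Icc f.left.1 f.right.1)
    (hy : y ∈ Set.Icc e.left.1 e.right.1) (hy' : y ∈ Set.Icc f.left.1 f.right.1)
    (h : e.height x < f.height x) : e.height y ≤ f.height y := by
  by_contra! hc
  rcases lt_trichotomy x y with hxy | rfl | hxy
  · exact hef (meets_of_lt_of_lt hxy hx.1 hy.2 hx'.1 hy'.2 (Or.inl ⟨h, hc⟩))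
  · linarith
  · exact hef (meets_of_lt_of_lt hxy hy.1 hx.2 hy'.1 hx'.2 (Or.inr ⟨hc, h⟩))

/-- `f` is the next segment after `e`, counterclockwise, among the segments of `E` which leave
the left endpoint of `e` to the right. -/
structure IsNext (E : Finset Seg) (e f : Seg) : Prop where
  mem : f ∈ E
  left_eq : f.left = e.left
  slope_lt : e.slope < f.slope
  slope_le : ∀ g ∈ E, g.left = e.left → e.slope < g.slope → f.slope ≤ g.slope

/-- The points of `V` in the triangle cut from the wedge between `e` and `f` by the vertical line
through the nearer of their right endpoints. -/
noncomputable def wedge (V : Finset (ℝ × ℝ)) (e f : Seg) : Finset (ℝ × ℝ) :=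
  {z ∈ V | e.left.1 < z.1 ∧ z.1 ≤ e.right.1 ∧ z.1 ≤ f.right.1 ∧
    e.height z.1 < z.2 ∧ z.2 < f.height z.1}

variable {E : Finset Seg}

lemma exists_isNext (he : ∃ f ∈ E, f.left = e.left ∧ e.slope < f.slope) :
    ∃ f, IsNext E e f := by
  obtain ⟨g, hg, hgl, hgs⟩ := he
  obtain ⟨f, hf, hmin⟩ := exists_min_image {f ∈ E | f.left = e.left ∧ e.slope < f.slope} slope
    ⟨g, by simp [hg, hgl, hgs]⟩
  simp only [mem_filter] at hf hmin
  exact ⟨f, hf.1, hf.2.1, hf.2.2, fun g hg h1 h2 => hmin g ⟨hg, h1, h2⟩⟩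

lemma IsNext.height_left (he : IsEdge V e) (hf : IsEdge V f) (h : IsNext E e f) :
    f.height e.left.1 = e.height e.left.1 := by
  rw [← he.left_on, ← h.left_eq, ← hf.left_on]

lemma IsNext.height_lt (he : IsEdge V e) (hf : IsEdge V f) (h : IsNext E e f) {x : ℝ}
    (hx : e.left.1 < x) : e.height x < f.height x := by
  have h1 := height_sub e x e.left.1
  have h2 := height_sub f x e.left.1
  rw [h.height_left he hf] at h2
  nlinarith [mul_pos (sub_pos.mpr h.slope_lt) (sub_pos.mpr hx)]

/-- `E` is the edge set of a straight-line drawing, without crossings, of a graph on `V`. -/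
structure IsPlane (V : Finset (ℝ × ℝ)) (E : Finset Seg) : Prop where
  isEdge : ∀ e ∈ E, IsEdge V e
  not_meets : ∀ e ∈ E, ∀ f ∈ E, e ≠ f → ¬ Meets e f

lemma IsPlane.height_le (hE : IsPlane V E) {x y : ℝ} (he : e ∈ E) (hf : f ∈ E)
    (hx : x ∈ Set.Icc e.left.1 e.right.1) (hx' : x ∈ Set.Icc f.left.1 f.right.1)
    (hy : y ∈ Set.Icc e.left.1 e.right.1) (hy' : y ∈ Set.Icc f.left.1 f.right.1)
    (h : e.height x < f.height x) : e.height y ≤ f.height y :=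
  height_le_of_not_meets (hE.not_meets e he f hf (by rintro rfl; exact lt_irrefl _ h))
    hx hx' hy hy' h

/-- If the wedge above `e` is empty and `e` ends first, then `e` is the topmost segment arriving
at its right endpoint. -/
lemma IsPlane.slope_le_of_wedge_eq_empty (hE : IsPlane V E) {g : Seg} (he : e ∈ E)
    (hf : IsNext E e f) (hw : wedge V e f = ∅) (hr : e.right.1 ≤ f.right.1) (hg : g ∈ E)
    (hgr : g.right = e.right) : e.slope ≤ g.slope := by
  by_contra! hs
  have e1 := hE.isEdge e he
  have f1 := hE.isEdge f hf.mem
  have g1 := hE.isEdge g hg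
  have hfl : f.left.1 = e.left.1 := by rw [hf.left_eq]
  have hgr1 : g.right.1 = e.right.1 := by rw [hgr]
  have hgt := g1.lt
  have het := e1.lt
  have hend : g.height e.right.1 = e.height e.right.1 := by
    rw [← e1.right_on, ← hgr, ← g1.right_on]
  have hlt : ∀ x < e.right.1, e.height x < g.height x := fun x hx => by
    have h1 := height_sub g e.right.1 x
    have h2 := height_sub e e.right.1 x
    nlinarith [mul_pos (sub_pos.mpr hs) (sub_pos.mpr hx)]
  have hfr := hf.height_lt e1 f1 het
  rcases lt_or_ge e.left.1 g.left.1 with h | h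
  · have h1 : g.height g.left.1 ≤ f.height g.left.1 :=
      hE.height_le (x := e.right.1) hg hf.mem ⟨by linarith, by linarith⟩
        ⟨by linarith, by linarith⟩ ⟨by linarith, by linarith⟩ ⟨by linarith, by linarith⟩
        (by linarith)
    have h2 := f1.interior _ g1.left_mem (by linarith) (by linarith)
    rw [← g1.left_on] at h1
    have h3 : g.left ∈ wedge V e f := by
      simp only [wedge, mem_filter]
      exact ⟨g1.left_mem, h, by linarith, by linarith,
        by rw [g1.left_on]; exact hlt _ (by linarith), lt_of_le_of_ne h1 h2⟩
    simp [hw] at h3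
  · have h1 : g.height e.left.1 ≤ f.height e.left.1 :=
      hE.height_le (x := e.right.1) hg hf.mem ⟨by linarith, by linarith⟩
        ⟨by linarith, by linarith⟩ ⟨by linarith, by linarith⟩ ⟨by linarith, by linarith⟩
        (by linarith)
    rw [hf.height_left e1 f1] at h1
    linarith [hlt _ het]

/-- If the wedge above `e` is empty and the next segment `f` ends first, then `f` is the
bottommost segment arriving at its right endpoint. -/
lemma IsPlane.le_slope_of_wedge_eq_empty (hE : IsPlane V E) {g : Seg} (he : e ∈ E)
    (hf : IsNext E e f) (hw : wedge V e f = ∅) (hr : f.right.1 ≤ e.right.1) (hg : g ∈ E)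
    (hgr : g.right = f.right) : g.slope ≤ f.slope := by
  by_contra! hs
  have e1 := hE.isEdge e he
  have f1 := hE.isEdge f hf.mem
  have g1 := hE.isEdge g hg
  have hfl : f.left.1 = e.left.1 := by rw [hf.left_eq]
  have hgr1 : g.right.1 = f.right.1 := by rw [hgr]
  have hgt := g1.lt
  have hft := f1.lt
  have hend : g.height f.right.1 = f.height f.right.1 := by
    rw [← f1.right_on, ← hgr, ← g1.right_on]
  have hlt : ∀ x < f.right.1, g.height x < f.height x := fun x hx => by
    have h1 := height_sub g f.right.1 x
    have h2 := height_sub f f.right.1 x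
    nlinarith [mul_pos (sub_pos.mpr hs) (sub_pos.mpr hx)]
  have hfr := hf.height_lt e1 f1 (x := f.right.1) (by linarith)
  rcases lt_or_ge e.left.1 g.left.1 with h | h
  · have h1 : e.height g.left.1 ≤ g.height g.left.1 :=
      hE.height_le (x := f.right.1) he hg ⟨by linarith, by linarith⟩
        ⟨by linarith, by linarith⟩ ⟨by linarith, by linarith⟩ ⟨by linarith, by linarith⟩
        (by linarith)
    have h2 := e1.interior _ g1.left_mem (by linarith) (by linarith)
    rw [← g1.left_on] at h1
    have h3 : g.left ∈ wedge V e f := by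
      simp only [wedge, mem_filter]
      exact ⟨g1.left_mem, h, by linarith, by linarith,
        lt_of_le_of_ne h1 h2.symm, by rw [g1.left_on]; exact hlt _ (by linarith)⟩
    simp [hw] at h3
  · have h1 : e.height e.left.1 ≤ g.height e.left.1 :=
      hE.height_le (x := f.right.1) he hg ⟨by linarith, by linarith⟩
        ⟨by linarith, by linarith⟩ ⟨by linarith, by linarith⟩ ⟨by linarith, by linarith⟩
        (by linarith)
    rw [← hf.height_left e1 f1] at h1
    linarith [hlt e.left.1 (by linarith)]

/-- A point is leftmost in at most one wedge. -/
lemma IsPlane.eq_of_mem_wedge (hE : IsPlane V E) {e' f' : Seg} {z : ℝ × ℝ}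
    (he : e ∈ E) (hf : IsNext E e f) (he' : e' ∈ E) (hf' : IsNext E e' f')
    (hz : z ∈ wedge V e f) (hmin : ∀ y ∈ wedge V e f, z.1 ≤ y.1)
    (hz' : z ∈ wedge V e' f') (hl : e.left.1 ≤ e'.left.1) : e = e' := by
  have e1 := hE.isEdge e he
  have f1 := hE.isEdge f hf.mem
  have e2 := hE.isEdge e' he'
  have f2 := hE.isEdge f' hf'.mem
  have hfl : f.left.1 = e.left.1 := by rw [hf.left_eq]
  have hfl' : f'.left.1 = e'.left.1 := by rw [hf'.left_eq]
  simp only [wedge, mem_filter] at hz hz'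
  obtain ⟨hzV, z1, z2, z3, z4, z5⟩ := hz
  obtain ⟨-, y1, y2, y3, y4, y5⟩ := hz'
  by_cases hv : e.left = e'.left
  · have key : ∀ {e f e' : Seg}, IsEdge V e → IsEdge V f → IsEdge V e' → e' ∈ E →
        IsNext E e f → e.left = e'.left → e.left.1 < z.1 → z.2 < f.height z.1 →
        e'.height z.1 < z.2 → e'.slope ≤ e.slope := by
      intro e f e' e1 f1 e2 he' hf hv h1 h2 h3
      by_contra! hs
      have h4 := hf.slope_le e' he' hv.symm hs
      have h5 := height_sub f z.1 e.left.1
      have h6 := height_sub e' z.1 e.left.1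
      have h7 : e'.height e.left.1 = e.height e.left.1 := by
        rw [← e1.left_on, hv, ← e2.left_on]
      rw [hf.height_left e1 f1] at h5
      nlinarith [mul_nonneg (sub_nonneg.mpr h4) (sub_pos.mpr h1).le]
    exact e1.eq_of_left_eq e2 hv (le_antisymm
      (key e2 f2 e1 he hf' hv.symm y1 y5 z4) (key e1 f1 e2 he' hf hv z1 z5 y4))
  exfalso
  rcases lt_trichotomy (e.height e'.left.1) e'.left.2 with h | h | h
  · rcases lt_trichotomy e'.left.2 (f.height e'.left.1) with h' | h' | h'
    · rcases hl.lt_or_eq with hl | hl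
      · have : e'.left ∈ wedge V e f := by
          simp only [wedge, mem_filter]
          exact ⟨e2.left_mem, hl, by linarith, by linarith, h, h'⟩
        linarith [hmin _ this]
      · rw [← hl] at h h'
        linarith [hf.height_left e1 f1]
    · rcases hl.lt_or_eq with hl | hl
      · exact f1.interior _ e2.left_mem (by linarith) (by linarith) h'
      · rw [← hl] at h h'
        linarith [hf.height_left e1 f1]
    · have := hE.height_le (x := e'.left.1) (y := z.1) hf.mem he' ⟨by linarith, by linarith⟩
        ⟨by linarith, by linarith⟩ ⟨by linarith, by linarith⟩ ⟨by linarith, by linarith⟩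
        (by rw [← e2.left_on]; exact h')
      linarith
  · rcases hl.lt_or_eq with hl | hl
    · exact e1.interior _ e2.left_mem hl (by linarith) h.symm
    · rw [← hl, ← e1.left_on] at h
      exact hv (Prod.ext hl h)
  · have := hE.height_le (x := e'.left.1) (y := z.1) hf'.mem he ⟨by linarith, by linarith⟩
      ⟨by linarith, by linarith⟩ ⟨by linarith, by linarith⟩ ⟨by linarith, by linarith⟩
      (by rw [hf'.height_left e2 f2, ← e2.left_on]; exact h)
    linarith

lemma IsNext.unique_left (hE : IsPlane V E) {e' : Seg} (he : e ∈ E) (he' : e' ∈ E)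
    (h : IsNext E e f) (h' : IsNext E e' f) : e = e' := by
  have hl : e.left = e'.left := h.left_eq.symm.trans h'.left_eq
  refine (hE.isEdge e he).eq_of_left_eq (hE.isEdge e' he') hl (le_antisymm ?_ ?_)
  · by_contra! hs
    exact absurd (h'.slope_le e he hl hs) (not_le.mpr h.slope_lt)
  · by_contra! hs
    exact absurd (h.slope_le e' he' hl.symm hs) (not_le.mpr h'.slope_lt)

/-- A plane straight-line graph has linearly many edges. -/
theorem IsPlane.card_le (hE : IsPlane V E) : #E ≤ 4 * #V := by
  classical
  have hnext : ∀ e : Seg, ∃ f, (∃ f, IsNext E e f) → IsNext E e f := fun e => by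
    by_cases h : ∃ f, IsNext E e f
    · exact h.imp fun f hf _ => hf
    · exact ⟨e, fun h' => absurd h' h⟩
  choose next hnext using hnext
  have hleftmost : ∀ e : Seg, ∃ z, (wedge V e (next e)).Nonempty →
      z ∈ wedge V e (next e) ∧ ∀ y ∈ wedge V e (next e), z.1 ≤ y.1 := fun e => by
    by_cases h : (wedge V e (next e)).Nonempty
    · obtain ⟨z, hz, hmin⟩ := exists_min_image _ Prod.fst h
      exact ⟨z, fun _ => ⟨hz, hmin⟩⟩
    · exact ⟨0, fun h' => absurd h' h⟩
  choose z hz using hleftmost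
  set D₁ := {e ∈ E | ¬ ∃ f, IsNext E e f} with hD₁
  set D₂ := {e ∈ E | (∃ f, IsNext E e f) ∧ wedge V e (next e) = ∅ ∧
    e.right.1 ≤ (next e).right.1} with hD₂
  set D₃ := {e ∈ E | (∃ f, IsNext E e f) ∧ wedge V e (next e) = ∅ ∧
    (next e).right.1 ≤ e.right.1} with hD₃
  set D₄ := {e ∈ E | (∃ f, IsNext E e f) ∧ (wedge V e (next e)).Nonempty} with hD₄
  have hcover : E ⊆ (D₁ ∪ D₂) ∪ (D₃ ∪ D₄) := by
    intro e he
    simp only [hD₁, hD₂, hD₃, hD₄, mem_union, mem_filter, he, true_and]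
    by_cases h : ∃ f, IsNext E e f
    · rcases (wedge V e (next e)).eq_empty_or_nonempty with hw | hw
      · rcases le_total e.right.1 (next e).right.1 with hr | hr
        · exact Or.inl (Or.inr ⟨h, hw, hr⟩)
        · exact Or.inr (Or.inl ⟨h, hw, hr⟩)
      · exact Or.inr (Or.inr ⟨h, hw⟩)
    · exact Or.inl (Or.inl h)
  have c₁ : #D₁ ≤ #V := by
    refine card_le_card_of_injOn left
      (fun e he => (hE.isEdge e (mem_filter.mp he).1).left_mem) fun e he e' he' hl => ?_
    obtain ⟨he, hn⟩ := mem_filter.mp he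
    obtain ⟨he', hn'⟩ := mem_filter.mp he'
    refine (hE.isEdge e he).eq_of_left_eq (hE.isEdge e' he') hl (le_antisymm ?_ ?_)
    · by_contra! hs
      exact hn' (exists_isNext ⟨e, he, hl, hs⟩)
    · by_contra! hs
      exact hn (exists_isNext ⟨e', he', hl.symm, hs⟩)
  have c₂ : #D₂ ≤ #V := by
    refine card_le_card_of_injOn right
      (fun e he => (hE.isEdge e (mem_filter.mp he).1).right_mem) fun e he e' he' hr => ?_
    obtain ⟨he, hn, hw, hle⟩ := mem_filter.mp he
    obtain ⟨he', hn', hw', hle'⟩ := mem_filter.mp he'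
    exact (hE.isEdge e he).eq_of_right_eq (hE.isEdge e' he') hr (le_antisymm
      (hE.slope_le_of_wedge_eq_empty he (hnext e hn) hw hle he' hr.symm)
      (hE.slope_le_of_wedge_eq_empty he' (hnext e' hn') hw' hle' he hr))
  have c₃ : #D₃ ≤ #V := by
    refine card_le_card_of_injOn (fun e => (next e).right)
      (fun e he => (hE.isEdge _ (hnext e (mem_filter.mp he).2.1).mem).right_mem)
      fun e he e' he' hr => ?_
    obtain ⟨he, hn, hw, hle⟩ := mem_filter.mp he
    obtain ⟨he', hn', hw', hle'⟩ := mem_filter.mp he'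
    have h := hnext e hn
    have h' := hnext e' hn'
    have heq : next e = next e' :=
      (hE.isEdge _ h.mem).eq_of_right_eq (hE.isEdge _ h'.mem) hr (le_antisymm
        (hE.le_slope_of_wedge_eq_empty he' h' hw' hle' h.mem hr)
        (hE.le_slope_of_wedge_eq_empty he h hw hle h'.mem hr.symm))
    exact h.unique_left hE he he' (heq ▸ h')
  have c₄ : #D₄ ≤ #V := by
    refine card_le_card_of_injOn z
      (fun e he => (mem_filter.mp (hz e (mem_filter.mp he).2.2).1).1) fun e he e' he' hzz => ?_
    obtain ⟨he, hn, hw⟩ := mem_filter.mp he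
    obtain ⟨he', hn', hw'⟩ := mem_filter.mp he'
    obtain ⟨h1, h2⟩ := hz e hw
    obtain ⟨h1', h2'⟩ := hz e' hw'
    rcases le_total e.left.1 e'.left.1 with hl | hl
    · exact hE.eq_of_mem_wedge he (hnext e hn) he' (hnext e' hn') h1 h2 (hzz ▸ h1') hl
    · exact (hE.eq_of_mem_wedge he' (hnext e' hn') he (hnext e hn) h1' h2' (hzz ▸ h1) hl).symm
  have := card_le_card hcover
  have := card_union_le (D₁ ∪ D₂) (D₃ ∪ D₄)
  have := card_union_le D₁ D₂
  have := card_union_le D₃ D₄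
  omega

end Seg

section sampling

variable {α ι : Type*} [DecidableEq α]

lemma sum_powerset_weight {V A : Finset α} (hA : A ⊆ V) (s : ℕ) :
    ∑ S ∈ V.powerset with A ⊆ S, s ^ (#V - #S) = (s + 1) ^ (#V - #A) := by
  have hset : {S ∈ V.powerset | A ⊆ S} = (V \ A).powerset.image (A ∪ ·) := by
    rw [← Icc_eq_image_powerset hA]
    ext S
    simp [and_comm]
  rw [hset, sum_image]
  · rw [← card_sdiff_of_subset hA, add_comm, ← sum_pow_mul_eq_add_pow]
    refine sum_congr rfl fun S hS => ?_
    rw [mem_powerset] at hS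
    have hdisj : Disjoint A S := disjoint_of_subset_right hS disjoint_sdiff
    rw [card_union_of_disjoint hdisj, card_sdiff_of_subset hA, one_pow, one_mul, Nat.sub_sub]
  · intro S hS T hT h
    simp only [coe_powerset, Set.mem_preimage, Set.mem_powerset_iff, coe_subset] at hS hT
    have hS' : Disjoint A S := disjoint_of_subset_right hS disjoint_sdiff
    have hT' : Disjoint A T := disjoint_of_subset_right hT disjoint_sdiff
    have := congrArg (· \ A) h
    simpa [union_sdiff_cancel_left, hS', hT'] using this

/-- Choosing each point of `V` with probability `1 / (s + 1)`, a given `j`-set survives with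
probability `1 / (s + 1) ^ j`. -/
lemma sum_weight_mul_card {V : Finset α} (I : Finset ι) (A : ι → Finset α) {j : ℕ}
    (hA : ∀ i ∈ I, A i ⊆ V) (hj : ∀ i ∈ I, #(A i) = j) (s : ℕ) :
    (∑ S ∈ V.powerset, s ^ (#V - #S) * #{i ∈ I | A i ⊆ S}) * (s + 1) ^ j =
      #I * (s + 1) ^ #V := by
  have h1 : ∑ S ∈ V.powerset, s ^ (#V - #S) * #{i ∈ I | A i ⊆ S} =
      ∑ i ∈ I, (s + 1) ^ (#V - j) := by
    simp_rw [card_filter, mul_sum]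
    rw [sum_comm]
    refine sum_congr rfl fun i hi => ?_
    rw [← hj i hi, ← sum_powerset_weight (hA i hi), sum_filter]
    simp only [mul_ite, mul_one, mul_zero]
  rw [h1, sum_const, smul_eq_mul, mul_assoc]
  rcases I.eq_empty_or_nonempty with rfl | ⟨i, hi⟩
  · simp
  · rw [← pow_add, Nat.sub_add_cancel (hj i hi ▸ card_le_card (hA i hi))]

lemma sum_weight_mul_card_self (V : Finset α) (s : ℕ) :
    (∑ S ∈ V.powerset, s ^ (#V - #S) * #S) * (s + 1) = #V * (s + 1) ^ #V := by
  rw [← sum_weight_mul_card V (fun v => {v}) (j := 1) (by simp) (by simp) s, pow_one]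
  congr 1
  refine sum_congr rfl fun S hS => ?_
  rw [mem_powerset] at hS
  simp only [singleton_subset_iff, filter_mem_eq_inter, inter_eq_right.mpr hS]

lemma sum_weight (V : Finset α) (s : ℕ) :
    ∑ S ∈ V.powerset, s ^ (#V - #S) = (s + 1) ^ #V := by
  simpa using sum_powerset_weight (V := V) (empty_subset V) s

/-- Independent sets in uniform hypergraphs with few edges. -/
theorem exists_independent {V : Finset α} {H : Finset (Finset α)} {k : ℕ}
    (hH : ∀ A ∈ H, A ⊆ V ∧ #A = k + 1) {t m : ℕ} (ht : 0 < t)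
    (hm : #H + m * t ^ (k + 1) < #V * t ^ k) :
    ∃ S ⊆ V, m < #S ∧ ∀ A ∈ H, ¬ A ⊆ S := by
  obtain ⟨s, rfl⟩ := Nat.exists_eq_add_one.mpr ht
  obtain ⟨S, hSV, hS⟩ : ∃ S ⊆ V, #{A ∈ H | A ⊆ S} + m < #S := by
    by_contra! hc
    have h1 : ∑ S ∈ V.powerset, s ^ (#V - #S) * #S ≤
        ∑ S ∈ V.powerset, s ^ (#V - #S) * #{A ∈ H | A ⊆ S} +
          m * ∑ S ∈ V.powerset, s ^ (#V - #S) := by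
      rw [mul_sum, ← sum_add_distrib]
      refine sum_le_sum fun S hS => ?_
      rw [mul_comm m, ← mul_add]
      exact Nat.mul_le_mul_left _ (hc S (mem_powerset.mp hS))
    have h2 := sum_weight_mul_card_self V s
    have h3 := sum_weight_mul_card H id (fun A hA => (hH A hA).1) (fun A hA => (hH A hA).2) s
    rw [sum_weight] at h1
    simp only [id] at h3
    have h4 := Nat.mul_le_mul_right ((s + 1) ^ (k + 1)) h1
    rw [add_mul, h3, pow_succ, mul_comm ((s + 1) ^ k), ← mul_assoc, h2] at h4
    have h5 := Nat.mul_lt_mul_of_pos_right hm (pow_pos ht #V)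
    rw [pow_succ] at h5
    nlinarith
  obtain ⟨v₀, -⟩ : S.Nonempty := card_pos.mp (by omega)
  have : Nonempty α := ⟨v₀⟩
  have hne : ∀ A ∈ {A ∈ H | A ⊆ S}, ∃ v, v ∈ A := fun A hA => by
    rw [mem_filter] at hA
    exact card_pos.mp (by rw [(hH A hA.1).2]; omega)
  choose! v hv using hne
  refine ⟨S \ image v {A ∈ H | A ⊆ S}, sdiff_subset.trans hSV, ?_, fun A hA hAS => ?_⟩
  · have h1 := le_card_sdiff (image v {A ∈ H | A ⊆ S}) S
    have h2 : #(image v {A ∈ H | A ⊆ S}) ≤ #{A ∈ H | A ⊆ S} := card_image_le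
    omega
  · have hmem : A ∈ {A ∈ H | A ⊆ S} := mem_filter.mpr ⟨hA, hAS.trans sdiff_subset⟩
    exact (mem_sdiff.mp (hAS (hv A hmem))).2 (mem_image_of_mem v hmem)

end sampling

namespace Seg

variable {V : Finset (ℝ × ℝ)} {E : Finset Seg} {e f : Seg}

open Classical in
/-- The ordered pairs of distinct segments of `E` which cross. -/
noncomputable def crossings (E : Finset Seg) : Finset (Seg × Seg) :=
  {p ∈ E ×ˢ E | p.1 ≠ p.2 ∧ Meets p.1 p.2}

lemma card_le_add_crossings (hE : ∀ e ∈ E, IsEdge V e) :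
    #E ≤ 4 * #V + #(crossings E) := by
  set F := E \ (crossings E).image Prod.fst with hF
  have hplane : IsPlane V F := by
    refine ⟨fun e he => hE e (mem_sdiff.mp he).1, fun e he f hf hne hm => ?_⟩
    refine (mem_sdiff.mp he).2 (mem_image.mpr ⟨(e, f), ?_, rfl⟩)
    simp only [crossings, mem_filter, mem_product]
    exact ⟨⟨(mem_sdiff.mp he).1, (mem_sdiff.mp hf).1⟩, hne, hm⟩
  have h1 := hplane.card_le
  have h2 := le_card_sdiff ((crossings E).image Prod.fst) E
  rw [← hF] at h2
  have h3 : #((crossings E).image Prod.fst) ≤ #(crossings E) := card_image_le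
  omega

lemma card_endpoints (he : IsEdge V e) : #{e.left, e.right} = 2 :=
  card_pair fun h => he.lt.ne (congrArg Prod.fst h)

lemma card_endpoints_of_meets (he : IsEdge V e) (hf : IsEdge V f) (hne : e ≠ f)
    (hm : Meets e f) : #({e.left, e.right} ∪ {f.left, f.right} : Finset (ℝ × ℝ)) = 4 := by
  obtain ⟨x, h1, h2, h3, h4, hx⟩ := hm
  have hline : ∀ y, x ≠ y → e.height y ≠ f.height y := fun y hy h =>
    hne (he.eq_of_overlap hf (line_eq_of_height_eq hy hx h) h1 h2 h3 h4)
  rw [card_union_of_disjoint, card_endpoints he, card_endpoints hf]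
  simp only [disjoint_insert_left, disjoint_singleton_left, mem_insert, mem_singleton, not_or]
  refine ⟨⟨fun h => ?_, fun h => ?_⟩, fun h => ?_, fun h => ?_⟩
  · refine hline e.left.1 h1.ne' ?_
    rw [← he.left_on, h, ← hf.left_on]
  · have := congrArg Prod.fst h
    linarith
  · have := congrArg Prod.fst h
    linarith
  · refine hline e.right.1 h2.ne ?_
    rw [← he.right_on, h, ← hf.right_on]

/-- The crossing lemma, in the form given by sampling points with probability `1 / t`. -/
theorem card_mul_sq_le (hE : ∀ e ∈ E, IsEdge V e) {t : ℕ} (ht : 0 < t) :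
    #E * t ^ 2 ≤ 4 * #V * t ^ 3 + #(crossings E) := by
  obtain ⟨s, rfl⟩ := Nat.exists_eq_add_one.mpr ht
  have hmem : ∀ p ∈ crossings E, p.1 ∈ E ∧ p.2 ∈ E ∧ p.1 ≠ p.2 ∧ Meets p.1 p.2 := by
    simp [crossings, and_assoc]
  have hsub : ∀ e ∈ E, ({e.left, e.right} : Finset (ℝ × ℝ)) ⊆ V := fun e he =>
    insert_subset (hE e he).left_mem (singleton_subset_iff.mpr (hE e he).right_mem)
  have h1 := sum_weight_mul_card E (fun e => ({e.left, e.right} : Finset (ℝ × ℝ))) hsub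
    (fun e he => card_endpoints (hE e he)) s
  have h2 := sum_weight_mul_card_self V s
  have h3 := sum_weight_mul_card (V := V) (crossings E)
    (fun p => ({p.1.left, p.1.right} ∪ {p.2.left, p.2.right} : Finset (ℝ × ℝ)))
    (fun p hp => union_subset (hsub _ (hmem p hp).1) (hsub _ (hmem p hp).2.1))
    (fun p hp => card_endpoints_of_meets (hE _ (hmem p hp).1) (hE _ (hmem p hp).2.1)
      (hmem p hp).2.2.1 (hmem p hp).2.2.2) s
  have h4 : ∑ S ∈ V.powerset, s ^ (#V - #S) *
        #{e ∈ E | ({e.left, e.right} : Finset (ℝ × ℝ)) ⊆ S} ≤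
      4 * ∑ S ∈ V.powerset, s ^ (#V - #S) * #S +
        ∑ S ∈ V.powerset, s ^ (#V - #S) * #{p ∈ crossings E |
          ({p.1.left, p.1.right} ∪ {p.2.left, p.2.right} : Finset (ℝ × ℝ)) ⊆ S} := by
    rw [mul_sum, ← sum_add_distrib]
    refine sum_le_sum fun S hS => ?_
    rw [mul_left_comm, ← mul_add]
    refine Nat.mul_le_mul_left _ ?_
    have hle := card_le_add_crossings (V := S)
      (E := {e ∈ E | ({e.left, e.right} : Finset (ℝ × ℝ)) ⊆ S}) fun e he => by
        rw [mem_filter] at he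
        exact (hE e he.1).mono (mem_powerset.mp hS) (he.2 (by simp)) (he.2 (by simp))
    refine hle.trans (Nat.add_le_add_left (card_le_card fun p hp => ?_) _)
    simp only [crossings, mem_filter, mem_product] at hp ⊢
    exact ⟨⟨⟨hp.1.1.1, hp.1.2.1⟩, hp.2⟩, union_subset hp.1.1.2 hp.1.2.2⟩
  have h5 := Nat.mul_le_mul_right ((s + 1) ^ 4) h4
  refine Nat.le_of_mul_le_mul_right ?_ (pow_pos ht #V)
  rw [add_mul, h3] at h5
  generalize (∑ S ∈ V.powerset, s ^ (#V - #S) *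
    #{e ∈ E | ({e.left, e.right} : Finset (ℝ × ℝ)) ⊆ S}) = w₁ at *
  generalize (∑ S ∈ V.powerset, s ^ (#V - #S) * #S) = w₂ at *
  calc #E * (s + 1) ^ 2 * (s + 1) ^ #V = w₁ * (s + 1) ^ 4 := by
        rw [mul_right_comm, ← h1]; ring
    _ ≤ _ := h5
    _ = 4 * (w₂ * (s + 1)) * (s + 1) ^ 3 + #(crossings E) * (s + 1) ^ #V := by ring
    _ = _ := by rw [h2]; ring

end Seg

/-- The points of `P` on the line `y = l.1 * x + l.2`. -/
noncomputable def pointsOn (P : Finset (ℝ × ℝ)) (l : ℝ × ℝ) : Finset (ℝ × ℝ) :=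
  {p ∈ P | p.2 = l.1 * p.1 + l.2}

lemma mem_pointsOn {P : Finset (ℝ × ℝ)} {l p : ℝ × ℝ} :
    p ∈ pointsOn P l ↔ p ∈ P ∧ p.2 = l.1 * p.1 + l.2 := by
  simp [pointsOn]

open Classical in
lemma card_le_card_consecutive (P : Finset (ℝ × ℝ)) (l : ℝ × ℝ) :
    #(pointsOn P l) ≤ #{q ∈ P ×ˢ P | Seg.IsEdge P (l, q)} + 1 := by
  rcases (pointsOn P l).eq_empty_or_nonempty with h | h
  · simp [h]
  obtain ⟨w, hw, hmax⟩ := exists_max_image _ Prod.fst h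
  rw [← card_erase_add_one hw]
  refine Nat.add_le_add_right ((card_le_card fun p hp => ?_).trans
    (card_image_le (f := Prod.fst))) 1
  obtain ⟨hpw, hp⟩ := mem_erase.mp hp
  have hlt : p.1 < w.1 := lt_of_le_of_ne (hmax p hp) fun h => hpw <| Prod.ext h <| by
    rw [(mem_pointsOn.mp hp).2, (mem_pointsOn.mp hw).2, h]
  obtain ⟨q, hq, hmin⟩ := exists_min_image {q ∈ pointsOn P l | p.1 < q.1} Prod.fst
    ⟨w, mem_filter.mpr ⟨hw, hlt⟩⟩
  rw [mem_filter, mem_pointsOn] at hq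
  rw [mem_pointsOn] at hp
  refine mem_image.mpr ⟨(p, q), mem_filter.mpr ⟨mem_product.mpr ⟨hp.1, hq.1.1⟩,
    hp.1, hq.1.1, hq.2, hp.2, hq.1.2, fun z hz h1 h2 h3 => ?_⟩, rfl⟩
  exact absurd (hmin z (mem_filter.mpr ⟨mem_pointsOn.mpr ⟨hz, h3⟩, h1⟩)) (not_le.mpr h2)

/-- Incidences of `M` lines, each with at least `i + 1` points of `P`, for every sampling rate. -/
lemma card_lines_mul_le (P L : Finset (ℝ × ℝ)) {i t : ℕ} (ht : 0 < t)
    (hL : ∀ l ∈ L, i + 1 ≤ #(pointsOn P l)) :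
    #L * i * t ^ 2 ≤ 4 * #P * t ^ 3 + #L ^ 2 := by
  classical
  set E : Finset Seg := {e ∈ L ×ˢ (P ×ˢ P) | Seg.IsEdge P e} with hE
  have hedge : ∀ e ∈ E, Seg.IsEdge P e := fun e he => (mem_filter.mp he).2
  have hcard : #L * i ≤ #E := by
    rw [hE, card_filter, sum_product, ← smul_eq_mul]
    refine card_nsmul_le_sum _ _ _ fun l hl => ?_
    rw [← card_filter]
    have := card_le_card_consecutive P l
    have := hL l hl
    omega
  have hcross : #(Seg.crossings E) ≤ #L ^ 2 := by
    rw [sq, ← card_product]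
    refine card_le_card_of_injOn (fun p => (p.1.1, p.2.1)) (fun p hp => ?_) ?_
    · simp only [Seg.crossings, coe_filter, mem_product, Set.mem_ofPred_eq, hE, mem_filter] at hp
      simp only [coe_product, Set.mem_prod, mem_coe]
      exact ⟨hp.1.1.1.1, hp.1.2.1.1⟩
    · rintro ⟨e, f⟩ hp ⟨e', f'⟩ hp' h
      simp only [Seg.crossings, coe_filter, mem_product, Set.mem_ofPred_eq] at hp hp'
      obtain ⟨⟨he, hf⟩, hne, x, h1, h2, h3, h4, hx⟩ := hp
      obtain ⟨⟨he', hf'⟩, -, y, k1, k2, k3, k4, hy⟩ := hp'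
      simp only [Prod.mk.injEq] at h
      have hxy : x = y := by
        by_contra hxy
        refine hne ((hedge e he).eq_of_overlap (hedge f hf)
          (Seg.line_eq_of_height_eq hxy hx ?_) h1 h2 h3 h4)
        simp only [Seg.height] at hy ⊢
        rw [h.1, h.2]
        exact hy
      subst hxy
      exact Prod.ext ((hedge e he).eq_of_overlap (hedge e' he') h.1 h1 h2 k1 k2)
        ((hedge f hf).eq_of_overlap (hedge f' hf') h.2 h3 h4 k3 k4)
  calc #L * i * t ^ 2 ≤ #E * t ^ 2 := Nat.mul_le_mul_right _ hcard
    _ ≤ _ := Seg.card_mul_sq_le hedge ht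
    _ ≤ _ := Nat.add_le_add_left hcross _

/-- Optimizing the sampling rate in `card_lines_mul_le`. -/
lemma mul_pow_three_le_of_sampling {N M i d : ℝ} (hN : 0 < N) (hi : 0 < i)
    (hd : i ^ 2 ≤ d ^ 2 * N)
    (key : ∀ t : ℕ, 0 < t → M * i * t ^ 2 ≤ 8 * N * t ^ 3 + 2 * M ^ 2) :
    M * i ^ 3 ≤ (16 * d ^ 2 + 4096) * N ^ 2 := by
  rcases lt_or_ge (M * i) (16 * N) with h | h
  · calc M * i ^ 3 = (M * i) * i ^ 2 := by ring
      _ ≤ (16 * N) * (d ^ 2 * N) := by gcongr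
      _ ≤ _ := by nlinarith [sq_nonneg N]
  · set u : ℝ := M * i / (16 * N) with hu
    have hu1 : 1 ≤ u := (one_le_div (by positivity)).mpr h
    have hMi : M * i = u * (16 * N) := by rw [hu]; field_simp
    have ht : 0 < ⌊u⌋₊ := Nat.floor_pos.mpr hu1
    have ht1 : (1 : ℝ) ≤ ⌊u⌋₊ := by exact_mod_cast ht
    have h1 : (⌊u⌋₊ : ℝ) ≤ u := Nat.floor_le (by linarith)
    have h2 : u ≤ 2 * ⌊u⌋₊ := by linarith [Nat.lt_floor_add_one u]
    have h3 := key _ ht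
    generalize (⌊u⌋₊ : ℝ) = t at *
    have hM : 0 < M := by
      refine pos_of_mul_pos_left (b := i) ?_ hi.le
      linarith
    have h4 : 8 * N * t ^ 3 ≤ M * i * t ^ 2 / 2 := by
      rw [hMi]
      have : 0 ≤ N * t ^ 2 * (u - t) := mul_nonneg (by positivity) (sub_nonneg.mpr h1)
      nlinarith
    have h5 : i * t ^ 2 ≤ 4 * M := by
      refine le_of_mul_le_mul_left ?_ hM
      nlinarith
    have h6 : M * i ≤ 32 * N * t := by
      rw [hMi]
      nlinarith
    have h8 : M * i ^ 3 ≤ 4096 * N ^ 2 := by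
      refine le_of_mul_le_mul_left ?_ hM
      calc M * (M * i ^ 3) = (M * i) ^ 2 * i := by ring
        _ ≤ (32 * N * t) ^ 2 * i := by gcongr
        _ = 1024 * N ^ 2 * (i * t ^ 2) := by ring
        _ ≤ 1024 * N ^ 2 * (4 * M) := by gcongr
        _ = _ := by ring
    nlinarith [mul_nonneg (sq_nonneg d) (sq_nonneg N)]

/-- The Szemerédi–Trotter bound on the number of rich lines. -/
theorem card_rich_lines_le (P L : Finset (ℝ × ℝ)) {i : ℕ} (hi : 2 ≤ i) {d : ℝ}
    (hd : (i : ℝ) ^ 2 ≤ d ^ 2 * #P) (hL : ∀ l ∈ L, i ≤ #(pointsOn P l)) :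
    (#L : ℝ) * (i : ℝ) ^ 3 ≤ (16 * d ^ 2 + 4096) * (#P : ℝ) ^ 2 := by
  have hi' : (2 : ℝ) ≤ i := by exact_mod_cast hi
  have hn : (0 : ℝ) < #P := by
    by_contra! hc
    nlinarith [mul_nonneg (sq_nonneg d) (neg_nonneg.mpr hc)]
  refine mul_pow_three_le_of_sampling hn (by linarith) hd fun t ht => ?_
  have h := card_lines_mul_le P L (i := i - 1) ht fun l hl => by have := hL l hl; omega
  have h' : (#L : ℝ) * ((i - 1 : ℕ) : ℝ) * t ^ 2 ≤ 4 * #P * t ^ 3 + (#L : ℝ) ^ 2 := by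
    exact_mod_cast h
  rw [Nat.cast_sub (by omega)] at h'
  push_cast at h'
  have : (0 : ℝ) ≤ #L * (i - 2) * t ^ 2 := by
    have := sub_nonneg.mpr hi'
    positivity
  nlinarith

lemma pow_four_le_sum (m : ℕ) : m ^ 4 ≤ 4 * ∑ i ∈ Icc 1 m, i ^ 3 := by
  induction m with
  | zero => simp
  | succ m ih =>
    rw [sum_Icc_succ_top (by omega)]
    have h : (m + 1) ^ 4 ≤ m ^ 4 + 4 * (m + 1) ^ 3 := by
      nlinarith [Nat.zero_le (m ^ 3), Nat.zero_le (m ^ 2)]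
    omega

lemma sum_pow_four_le (P L : Finset (ℝ × ℝ)) {l : ℕ} {d : ℝ} (hd : (l : ℝ) ^ 2 ≤ d ^ 2 * #P)
    (hL : ∀ a ∈ L, 2 ≤ #(pointsOn P a)) (hl : ∀ a ∈ L, #(pointsOn P a) ≤ l) :
    ∑ a ∈ L, (#(pointsOn P a) : ℝ) ^ 4 ≤ 4 * (16 * d ^ 2 + 4096) * (#P : ℝ) ^ 2 * l := by
  have hrich : ∀ i ∈ Icc 1 l, (i : ℝ) ^ 3 * #{a ∈ L | i ≤ #(pointsOn P a)} ≤
      (16 * d ^ 2 + 4096) * (#P : ℝ) ^ 2 := by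
    intro i hi
    rw [mem_Icc] at hi
    rcases L.eq_empty_or_nonempty with rfl | ⟨a, ha⟩
    · simp; positivity
    have hl2 : 2 ≤ l := (hL a ha).trans (hl a ha)
    have hmax : max 2 i ≤ l := max_le hl2 hi.2
    have h := card_rich_lines_le P {a ∈ L | i ≤ #(pointsOn P a)} (i := max 2 i)
      (le_max_left _ _) (d := d) (le_trans (by gcongr) hd) fun a ha => by
        rw [mem_filter] at ha
        exact max_le (hL a ha.1) ha.2
    refine le_trans ?_ h
    rw [mul_comm]
    gcongr
    exact le_max_right _ _
  calc ∑ a ∈ L, (#(pointsOn P a) : ℝ) ^ 4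
      ≤ ∑ a ∈ L, 4 * ∑ i ∈ Icc 1 l, if i ≤ #(pointsOn P a) then (i : ℝ) ^ 3 else 0 := by
        refine sum_le_sum fun a ha => ?_
        have h := pow_four_le_sum #(pointsOn P a)
        have hset : Icc 1 #(pointsOn P a) = {i ∈ Icc 1 l | i ≤ #(pointsOn P a)} := by
          ext i
          have := hl a ha
          simp only [mem_Icc, mem_filter]
          omega
        rw [← sum_filter, ← hset]
        exact_mod_cast h
    _ = 4 * ∑ i ∈ Icc 1 l, (i : ℝ) ^ 3 * #{a ∈ L | i ≤ #(pointsOn P a)} := by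
        rw [← mul_sum, sum_comm]
        congr 1
        refine sum_congr rfl fun i _ => ?_
        rw [← sum_filter, sum_const, nsmul_eq_mul, mul_comm]
    _ ≤ 4 * ∑ i ∈ Icc 1 l, (16 * d ^ 2 + 4096) * (#P : ℝ) ^ 2 := by
        exact mul_le_mul_of_nonneg_left (sum_le_sum hrich) (by norm_num)
    _ = _ := by
        rw [sum_const, Nat.card_Icc, nsmul_eq_mul, Nat.add_sub_cancel]
        ring

lemma collinear_pointsOn (P : Finset (ℝ × ℝ)) (a : ℝ × ℝ) :
    Collinear ℝ (pointsOn P a : Set (ℝ × ℝ)) := by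
  rw [collinear_iff_exists_forall_eq_smul_vadd]
  refine ⟨(0, a.2), (1, a.1), fun p hp => ⟨p.1, ?_⟩⟩
  rw [mem_coe, mem_pointsOn] at hp
  refine Prod.ext (by simp) ?_
  simp only [vadd_eq_add, Prod.snd_add, Prod.smul_snd, smul_eq_mul]
  rw [hp.2]
  ring

lemma collinear_column (P : Finset (ℝ × ℝ)) (x : ℝ) :
    Collinear ℝ (({p ∈ P | p.1 = x} : Finset (ℝ × ℝ)) : Set (ℝ × ℝ)) := by
  rw [collinear_iff_exists_forall_eq_smul_vadd]
  refine ⟨(x, 0), (0, 1), fun p hp => ⟨p.2, ?_⟩⟩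
  rw [mem_coe, mem_filter] at hp
  exact Prod.ext (by simp [hp.2]) (by simp)

/-- The non-vertical line through two points. -/
noncomputable def lineThrough (p q : ℝ × ℝ) : ℝ × ℝ :=
  ((q.2 - p.2) / (q.1 - p.1), p.2 - (q.2 - p.2) / (q.1 - p.1) * p.1)

lemma on_lineThrough_left (p q : ℝ × ℝ) :
    p.2 = (lineThrough p q).1 * p.1 + (lineThrough p q).2 := by
  simp [lineThrough]

lemma on_lineThrough_right {p q : ℝ × ℝ} (h : p.1 ≠ q.1) :
    q.2 = (lineThrough p q).1 * q.1 + (lineThrough p q).2 := by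
  have := sub_ne_zero.mpr h.symm
  simp only [lineThrough]
  field_simp
  ring

lemma on_lineThrough_of_collinear {T : Set (ℝ × ℝ)} (hT : Collinear ℝ T) {p q r : ℝ × ℝ}
    (hp : p ∈ T) (hq : q ∈ T) (hr : r ∈ T) (h : p.1 ≠ q.1) :
    r.2 = (lineThrough p q).1 * r.1 + (lineThrough p q).2 := by
  obtain ⟨v, hv⟩ := (collinear_iff_of_mem hp).mp hT
  obtain ⟨s, rfl⟩ := hv q hq
  obtain ⟨t, rfl⟩ := hv r hr
  simp only [vadd_eq_add, Prod.fst_add, Prod.smul_fst, smul_eq_mul, ne_eq,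
    right_eq_add, mul_eq_zero, not_or] at h
  have := h.1
  have := h.2
  simp only [lineThrough, vadd_eq_add, Prod.fst_add, Prod.smul_fst, smul_eq_mul, Prod.snd_add,
    Prod.smul_snd, add_sub_cancel_right]
  field_simp
  ring

/-- The lines spanned by pairs of points of `P` with distinct abscissae. -/
noncomputable def spannedLines (P : Finset (ℝ × ℝ)) : Finset (ℝ × ℝ) :=
  {p ∈ P ×ˢ P | p.1.1 ≠ p.2.1}.image fun p => lineThrough p.1 p.2

lemma two_le_card_pointsOn {P : Finset (ℝ × ℝ)} {a : ℝ × ℝ} (ha : a ∈ spannedLines P) :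
    2 ≤ #(pointsOn P a) := by
  obtain ⟨⟨p, q⟩, h, rfl⟩ := mem_image.mp ha
  simp only [mem_filter, mem_product] at h
  refine one_lt_card.mpr ⟨p, mem_pointsOn.mpr ⟨h.1.1, on_lineThrough_left p q⟩, q,
    mem_pointsOn.mpr ⟨h.1.2, on_lineThrough_right h.2⟩, fun hpq => h.2 (by rw [hpq])⟩

/-- A set of `n` points with at most `l` collinear contains `O(n² l^(j+1))` collinear
`(j+4)`-sets. -/
theorem card_collinear_subsets_le {P : Finset (ℝ × ℝ)} {l : ℕ} {d : ℝ}
    (hd : (l : ℝ) ^ 2 ≤ d ^ 2 * #P) (hP : AtMostCollinear P l) (j : ℕ)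
    {H : Finset (Finset (ℝ × ℝ))}
    (hH : ∀ T ∈ H, T ⊆ P ∧ #T = j + 4 ∧ Collinear ℝ (T : Set (ℝ × ℝ))) :
    (#H : ℝ) ≤ (65 * d ^ 2 + 16384) * (#P : ℝ) ^ 2 * (l : ℝ) ^ (j + 1) := by
  set A := (spannedLines P).biUnion fun a => (pointsOn P a).powersetCard (j + 4) with hA
  set B := (P.image Prod.fst).biUnion fun x => {p ∈ P | p.1 = x}.powersetCard (j + 4) with hB
  have hcover : H ⊆ A ∪ B := by
    intro T hT
    obtain ⟨hTP, hTc, hTl⟩ := hH T hT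
    obtain ⟨p, hp⟩ : T.Nonempty := card_pos.mp (by omega)
    simp only [hA, hB, mem_union, mem_biUnion, mem_powersetCard]
    by_cases h : ∃ q ∈ T, p.1 ≠ q.1
    · obtain ⟨q, hq, hpq⟩ := h
      refine Or.inl ⟨lineThrough p q, mem_image.mpr ⟨(p, q), ?_, rfl⟩, fun r hr => ?_, hTc⟩
      · simp [hTP hp, hTP hq, hpq]
      · exact mem_pointsOn.mpr ⟨hTP hr, on_lineThrough_of_collinear hTl hp hq hr hpq⟩
    · push Not at h
      exact Or.inr ⟨p.1, mem_image_of_mem _ (hTP hp), fun r hr =>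
        mem_filter.mpr ⟨hTP hr, (h r hr).symm⟩, hTc⟩
  have hchoose : ∀ m ≤ l, (m.choose (j + 4) : ℝ) ≤ (l : ℝ) ^ j * (m : ℝ) ^ 4 := fun m hm => by
    calc (m.choose (j + 4) : ℝ) ≤ (m : ℝ) ^ (j + 4) := by exact_mod_cast Nat.choose_le_pow _ _
      _ = (m : ℝ) ^ j * (m : ℝ) ^ 4 := pow_add _ _ _
      _ ≤ _ := by gcongr
  have hline : ∀ a, #(pointsOn P a) ≤ l := fun a =>
    hP _ (filter_subset _ _) (collinear_pointsOn P a)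
  have hcol : ∀ x, #{p ∈ P | p.1 = x} ≤ l := fun x =>
    hP _ (filter_subset _ _) (collinear_column P x)
  have cA : (#A : ℝ) ≤ (l : ℝ) ^ j * (4 * (16 * d ^ 2 + 4096) * (#P : ℝ) ^ 2 * l) := by
    calc (#A : ℝ) ≤ ∑ a ∈ spannedLines P, ((#(pointsOn P a)).choose (j + 4) : ℝ) := by
          refine (Nat.cast_le.mpr card_biUnion_le).trans_eq ?_
          simp
      _ ≤ ∑ a ∈ spannedLines P, (l : ℝ) ^ j * (#(pointsOn P a) : ℝ) ^ 4 :=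
          sum_le_sum fun a _ => hchoose _ (hline a)
      _ ≤ _ := by
          rw [← mul_sum]
          gcongr
          exact sum_pow_four_le P _ hd (fun a => two_le_card_pointsOn) fun a _ => hline a
  have cB : (#B : ℝ) ≤ (l : ℝ) ^ (j + 1) * (l : ℝ) ^ 2 * #P := by
    calc (#B : ℝ) ≤ ∑ x ∈ P.image Prod.fst, ((#{p ∈ P | p.1 = x}).choose (j + 4) : ℝ) := by
          refine (Nat.cast_le.mpr card_biUnion_le).trans_eq ?_
          simp
      _ ≤ ∑ x ∈ P.image Prod.fst, (l : ℝ) ^ (j + 3) * (#{p ∈ P | p.1 = x} : ℝ) := by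
          refine sum_le_sum fun x _ => (hchoose _ (hcol x)).trans ?_
          have : (#{p ∈ P | p.1 = x} : ℝ) ≤ l := by exact_mod_cast hcol x
          rw [pow_add, mul_assoc, pow_succ _ 3]
          gcongr
      _ = (l : ℝ) ^ (j + 3) * #P := by
          rw [← mul_sum, card_eq_sum_card_image Prod.fst P]
          push_cast
          rfl
      _ = _ := by ring
  have cH : (#H : ℝ) ≤ #A + #B := by
    exact_mod_cast (card_le_card hcover).trans (card_union_le _ _)
  have : (l : ℝ) ^ (j + 1) * (l : ℝ) ^ 2 * #P ≤ (l : ℝ) ^ (j + 1) * (d ^ 2 * #P) * #P := by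
    gcongr
  calc (#H : ℝ) ≤ _ := cH.trans (add_le_add cA (cB.trans this))
    _ = _ := by ring

end

/-- For every fixed `k ≥ 3` and `d > 0` there is `c > 0` such that every set of `n` points
in the plane with at most `ℓ` collinear, where `k < ℓ ≤ d·√n`, contains at least
`c·n^((k−1)/k) / ℓ^((k−2)/k)` points with at most `k` collinear. -/
theorem at_most_k_collinear_subset :
    ∀ k : ℕ, 3 ≤ k →
    ∀ d : ℝ, 0 < d →
    ∃ c : ℝ, 0 < c ∧
      ∀ (n ℓ : ℕ) (P : Finset (ℝ × ℝ)),
        k < ℓ → (ℓ : ℝ) ≤ d * Real.sqrt n → P.card = n → AtMostCollinear P ℓ →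
        ∃ S ⊆ P, AtMostCollinear S k ∧
          c * (n : ℝ) ^ (((k : ℝ) - 1) / (k : ℝ)) /
              (ℓ : ℝ) ^ (((k : ℝ) - 2) / (k : ℝ)) ≤ S.card := by
  classical
  intro k hk d hd
  obtain ⟨j, rfl⟩ : ∃ j, k = j + 3 := ⟨k - 3, by omega⟩
  set D : ℝ := 2 * (65 * d ^ 2 + 16384) with hD
  have hD1 : 1 ≤ D := by nlinarith [sq_nonneg d]
  have hk0 : ((j + 3 : ℕ) : ℝ) ≠ 0 := by positivity
  refine ⟨1 / (4 * D ^ (1 / ((j + 3 : ℕ) : ℝ))), by positivity, ?_⟩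
  intro n ℓ P hkl hl hPn hP
  have hl1 : (1 : ℝ) ≤ ℓ := by exact_mod_cast (by omega : 1 ≤ ℓ)
  have hn0 : n ≠ 0 := by
    rintro rfl
    simp at hl
    linarith
  have hn1 : (1 : ℝ) ≤ n := by exact_mod_cast Nat.one_le_iff_ne_zero.mpr hn0
  have hsq : (ℓ : ℝ) ^ 2 ≤ d ^ 2 * P.card := by
    rw [hPn]
    calc (ℓ : ℝ) ^ 2 ≤ (d * Real.sqrt n) ^ 2 := by gcongr
      _ = _ := by rw [mul_pow, Real.sq_sqrt (by positivity)]
  set H : Finset (Finset (ℝ × ℝ)) :=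
    {T ∈ P.powersetCard (j + 4) | Collinear ℝ (T : Set (ℝ × ℝ))} with hH
  have hHmem : ∀ T ∈ H, T ⊆ P ∧ T.card = j + 4 ∧ Collinear ℝ (T : Set (ℝ × ℝ)) := fun T hT => by
    rw [hH, Finset.mem_filter, Finset.mem_powersetCard] at hT
    exact ⟨hT.1.1, hT.1.2, hT.2⟩
  have hHcard := card_collinear_subsets_le hsq hP j hHmem
  rw [hPn] at hHcard
  set K : ℝ := D * n * (ℓ : ℝ) ^ (j + 1) with hK
  have hK1 : 1 ≤ K :=
    one_le_mul_of_one_le_of_one_le (one_le_mul_of_one_le_of_one_le hD1 hn1) (one_le_pow₀ hl1)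
  set u : ℝ := K ^ (1 / ((j + 3 : ℕ) : ℝ)) with hu
  have hu1 : 1 ≤ u := Real.one_le_rpow hK1 (by positivity)
  have huK : u ^ (j + 3) = K := by
    rw [hu, one_div]
    exact Real.rpow_inv_natCast_pow (by linarith) (by omega)
  set t := ⌈u⌉₊ with ht
  have htu : u ≤ t := Nat.le_ceil u
  have htu2 : (t : ℝ) ≤ 2 * u := by linarith [Nat.ceil_lt_add_one (by linarith : 0 ≤ u)]
  have ht0 : 0 < t := Nat.ceil_pos.mpr (by linarith)
  have ht0' : (0 : ℝ) < t := by exact_mod_cast ht0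
  have hH2 : 2 * (H.card : ℝ) ≤ n * (t : ℝ) ^ (j + 3) := by
    calc 2 * (H.card : ℝ) ≤ n * K := by rw [hK, hD]; linarith
      _ = n * u ^ (j + 3) := by rw [huK]
      _ ≤ _ := by gcongr
  set y : ℝ := n / (2 * t) with hy
  have hy0 : 0 < y := by positivity
  obtain ⟨m, hm⟩ : ∃ m, ⌈y⌉₊ = m + 1 := Nat.exists_eq_add_one.mpr (Nat.ceil_pos.mpr hy0)
  have hmy : (m : ℝ) < y := Nat.lt_ceil.mp (by omega)
  obtain ⟨S, hSP, hmS, hS⟩ := exists_independent (V := P) (H := H) (k := j + 3) (t := t) (m := m)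
    (fun T hT => ⟨(hHmem T hT).1, (hHmem T hT).2.1⟩) ht0 (by
      have h1 : (m : ℝ) * (t : ℝ) ^ (j + 3 + 1) < n * (t : ℝ) ^ (j + 3) / 2 := by
        calc (m : ℝ) * (t : ℝ) ^ (j + 3 + 1) < y * (t : ℝ) ^ (j + 3 + 1) := by gcongr
          _ = _ := by rw [hy, pow_succ]; field_simp
      rw [hPn]
      have : (H.card : ℝ) + m * (t : ℝ) ^ (j + 3 + 1) < n * (t : ℝ) ^ (j + 3) := by linarith
      exact_mod_cast this)
  refine ⟨S, hSP, fun T hT hTl => ?_, ?_⟩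
  · by_contra! hc
    obtain ⟨T', hT', hcard⟩ := Finset.exists_subset_card_eq (s := T) (n := j + 4) (by omega)
    refine hS T' ?_ (hT'.trans hT)
    rw [hH, Finset.mem_filter, Finset.mem_powersetCard]
    exact ⟨⟨(hT'.trans hT).trans hSP, hcard⟩, hTl.subset (by exact_mod_cast hT')⟩
  · have hyS : y ≤ S.card := (Nat.le_ceil y).trans (by exact_mod_cast (by omega : ⌈y⌉₊ ≤ S.card))
    refine le_trans ?_ hyS
    have h1 : (n : ℝ) / (4 * u) ≤ y := by
      rw [hy]
      refine div_le_div_of_nonneg_left (by positivity) (by positivity) ?_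
      linarith
    refine le_trans (le_of_eq ?_) h1
    have hupow : u = D ^ (1 / ((j + 3 : ℕ) : ℝ)) * (n : ℝ) ^ (1 / ((j + 3 : ℕ) : ℝ)) *
        (ℓ : ℝ) ^ ((((j + 3 : ℕ) : ℝ) - 2) / ((j + 3 : ℕ) : ℝ)) := by
      rw [hu, hK, Real.mul_rpow (by positivity) (by positivity),
        Real.mul_rpow (by positivity) (by positivity), ← Real.rpow_natCast (ℓ : ℝ),
        ← Real.rpow_mul (by positivity)]
      congr 2
      push_cast
      ring
    have hnpow : (n : ℝ) ^ ((((j + 3 : ℕ) : ℝ) - 1) / ((j + 3 : ℕ) : ℝ)) *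
        (n : ℝ) ^ (1 / ((j + 3 : ℕ) : ℝ)) = n := by
      rw [← Real.rpow_add (by linarith), ← add_div, sub_add_cancel, div_self hk0, Real.rpow_one]
    rw [hupow]
    nth_rewrite 2 [← hnpow]
    have p1 : (n : ℝ) ^ (1 / ((j + 3 : ℕ) : ℝ)) ≠ 0 := by positivity
    have p2 : D ^ (1 / ((j + 3 : ℕ) : ℝ)) ≠ 0 := by positivity
    have p3 : (ℓ : ℝ) ^ ((((j + 3 : ℕ) : ℝ) - 2) / ((j + 3 : ℕ) : ℝ)) ≠ 0 := by positivity
    generalize (n : ℝ) ^ (1 / ((j + 3 : ℕ) : ℝ)) = a₁ at *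
    generalize D ^ (1 / ((j + 3 : ℕ) : ℝ)) = a₂ at *
    generalize (ℓ : ℝ) ^ ((((j + 3 : ℕ) : ℝ) - 2) / ((j + 3 : ℕ) : ℝ)) = a₃ at *
    field_simp
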